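/- (Sharp Trudinger–Moser inequality on ℝ².) For every μ > 0 there exists a finite constant C(μ) such that every u ∈ H¹(ℝ²) with ‖∇u‖²_{L²} + μ²‖u‖²_{L²} ≤ 1 satisfies ∫_{ℝ²} (e^{4π|u(x)|²} − 1) dx ≤ C(μ). -/

import Mathlib

open MeasureTheory Real Classical
open scoped ENNReal RealInnerProductSpace

noncomputable section

/-- The plane `ℝ²`. -/
abbrev Plane := EuclideanSpace ℝ (Fin 2)

/-- Pointwise norm of the (full) gradient of `u`. -/
def gradNorm (u : Plane → ℝ) (x : Plane) : ℝ := ‖fderiv ℝ u x‖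

/-- The `L^p` norm for a real (finite) exponent `p`. -/
def LpNorm (p : ℝ) (u : Plane → ℝ) : ℝ := (∫ x : Plane, |u x| ^ p) ^ (1 / p)

/-- The sup (`L^∞`) norm. -/
def supNorm (u : Plane → ℝ) : ℝ := ⨆ x : Plane, |u x|

/-- The homogeneous Hölder seminorm `[u]_α`. -/
def holderSemi (α : ℝ) (u : Plane → ℝ) : ℝ :=
  ⨆ p : Plane × Plane,
    if p.1 = p.2 then 0 else |u p.1 - u p.2| / ‖p.1 - p.2‖ ^ α

/-- The Hölder norm `‖u‖_{C^α} = sup |u| + [u]_α`. -/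
def holderNorm (α : ℝ) (u : Plane → ℝ) : ℝ := supNorm u + holderSemi α u

/-- `u` is `α`-Hölder continuous. -/
def IsHolder (α : ℝ) (u : Plane → ℝ) : Prop :=
  ∃ C : ℝ, 0 ≤ C ∧ ∀ x y : Plane, |u x - u y| ≤ C * ‖x - y‖ ^ α

/-- The squared `H¹` norm `‖∇u‖_{L²}² + ‖u‖_{L²}²`. -/
def H1Sq (u : Plane → ℝ) : ℝ :=
  (∫ x : Plane, gradNorm u x ^ 2) + ∫ x : Plane, u x ^ 2

/-- The squared local `H¹` norm `‖u‖_{H¹[R]}²`. -/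
def H1locSq (R : ℝ) (u : Plane → ℝ) : ℝ :=
  ⨆ c : Plane, ∫ x in Metric.closedBall c R, (gradNorm u x ^ 2 + u x ^ 2)

/-- Membership in `H¹(ℝ²)` (with classical derivatives). -/
def MemH1 (u : Plane → ℝ) : Prop :=
  Differentiable ℝ u ∧ Integrable (fun x => u x ^ 2) ∧
    Integrable (fun x => gradNorm u x ^ 2)

/-- The nonlinearity `f(u) = (e^{4π u²} - 1 - 4π u²) u`. -/
def f (s : ℝ) : ℝ := (Real.exp (4 * π * s ^ 2) - 1 - 4 * π * s ^ 2) * s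

/-- The potential `F(u) = (1/8π)(e^{4π u²} - 1 - 4π u² - 8π² u⁴)`. -/
def F (s : ℝ) : ℝ :=
  (8 * π)⁻¹ * (Real.exp (4 * π * s ^ 2) - 1 - 4 * π * s ^ 2 - 8 * π ^ 2 * s ^ 4)

/-- The unit vector of `ℝ²` at angle `θ`. -/
def unitVec (θ : ℝ) : Plane := !₂[cos θ, sin θ]

lemma norm_unitVec (θ : ℝ) : ‖unitVec θ‖ = 1 := by
  simp [unitVec, EuclideanSpace.norm_eq]

lemma continuous_unitVec : Continuous unitVec := by
  unfold unitVec
  fun_prop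

/-- Integration over the plane in polar coordinates centred at `x`. -/
lemma lintegral_polar (x : Plane) {G : Plane → ℝ≥0∞} (hG : Measurable G) :
    ∫⁻ y, G y = ∫⁻ θ in Set.Ioo (-π) π, ∫⁻ r in Set.Ioi (0 : ℝ),
      ENNReal.ofReal r * G (x + r • unitVec θ) := by
  have e1 : ∫⁻ y, G y = ∫⁻ z : ℂ, G (x + Complex.orthonormalBasisOneI.repr z) := by
    rw [← lintegral_add_left_eq_self G x]
    exact ((Complex.orthonormalBasisOneI.measurePreserving_repr).lintegral_comp
      (hG.comp (measurable_const_add x))).symm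
  have hm : Measurable fun p : ℝ × ℝ => ENNReal.ofReal p.1 * G (x + p.1 • unitVec p.2) := by
    refine (ENNReal.measurable_ofReal.comp measurable_fst).mul (hG.comp ?_)
    have := continuous_unitVec
    exact Continuous.measurable (by fun_prop)
  have e2 : ∀ p : ℝ × ℝ, Complex.orthonormalBasisOneI.repr (Complex.polarCoord.symm p)
      = p.1 • unitVec p.2 := by
    intro p
    ext i
    fin_cases i <;> simp [unitVec, Complex.polarCoord_symm_apply, Complex.cos_ofReal_re,
      Complex.sin_ofReal_re]
  rw [e1, ← Complex.lintegral_comp_polarCoord_symm]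
  simp only [e2, smul_eq_mul]
  rw [polarCoord_target, Measure.volume_eq_prod, ← Measure.prod_restrict,
    lintegral_prod_symm _ hm.aemeasurable]

/-- The integral of a radial function on the plane. -/
lemma lintegral_radial (x : Plane) {N : ℝ → ℝ≥0∞} (hN : Measurable N) :
    ∫⁻ y, N ‖x - y‖ = ENNReal.ofReal (2 * π) *
      ∫⁻ r in Set.Ioi (0 : ℝ), ENNReal.ofReal r * N r := by
  rw [lintegral_polar x (G := fun y => N ‖x - y‖) (hN.comp (by fun_prop))]
  have : ∀ θ : ℝ, ∫⁻ r in Set.Ioi (0 : ℝ), ENNReal.ofReal r * N ‖x - (x + r • unitVec θ)‖ =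
      ∫⁻ r in Set.Ioi (0 : ℝ), ENNReal.ofReal r * N r := by
    intro θ
    refine setLIntegral_congr_fun measurableSet_Ioi fun r hr => ?_
    have : ‖x - (x + r • unitVec θ)‖ = r := by
      rw [sub_add_cancel_left, norm_neg, norm_smul, norm_unitVec, mul_one, Real.norm_eq_abs,
        abs_of_pos hr]
    simp only [this]
  simp only [this, lintegral_const, Measure.restrict_apply_univ,
    Real.volume_Ioo]
  rw [mul_comm]
  congr 2
  ring
/-- Along a ray that meets `{|u| ≤ A}`, the excess `|u| - A` at the origin of the ray is bounded by
the integral of the gradient over the part of the ray where `|u| > A`. -/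
lemma ofReal_sub_le_lintegral_ray {u : Plane → ℝ} (hu : Differentiable ℝ u) {A : ℝ} (x e : Plane)
    (he : ‖e‖ = 1) {r : ℝ} (hr : 0 ≤ r) (hrA : |u (x + r • e)| ≤ A) :
    ENNReal.ofReal (|u x| - A) ≤ ∫⁻ s in Set.Ioi (0 : ℝ),
      {y | A < |u y|}.indicator (fun y => ‖fderiv ℝ u y‖ₑ) (x + s • e) := by
  have hcont : Continuous fun s : ℝ => |u (x + s • e)| := by
    have := hu.continuous
    fun_prop
  have hne : (Set.Ici (0 : ℝ) ∩ {s | |u (x + s • e)| ≤ A}).Nonempty := ⟨r, hr, hrA⟩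
  have hbd : BddBelow (Set.Ici (0 : ℝ) ∩ {s | |u (x + s • e)| ≤ A}) := ⟨0, fun s hs => hs.1⟩
  have hcl : IsClosed (Set.Ici (0 : ℝ) ∩ {s | |u (x + s • e)| ≤ A}) :=
    isClosed_Ici.inter (isClosed_le hcont continuous_const)
  obtain ⟨r₀, ⟨hr₀, hr₀A⟩, hmin⟩ : ∃ r₀, r₀ ∈ Set.Ici (0 : ℝ) ∩ {s | |u (x + s • e)| ≤ A} ∧
      ∀ s ∈ Set.Ici (0 : ℝ) ∩ {s | |u (x + s • e)| ≤ A}, r₀ ≤ s :=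
    ⟨_, hcl.csInf_mem hne hbd, fun s hs => csInf_le hbd hs⟩
  have hr₀0 : 0 ≤ r₀ := hr₀
  have hr₀A' : |u (x + r₀ • e)| ≤ A := hr₀A
  have hder : ∀ s : ℝ, HasDerivAt (fun s : ℝ => u (x + s • e)) (fderiv ℝ u (x + s • e) e) s := by
    intro s
    have h1 : HasDerivAt (fun s : ℝ => x + s • e) e s := by
      simpa using ((hasDerivAt_id s).smul_const e).const_add x
    exact (hu (x + s • e)).hasFDerivAt.comp_hasDerivAt s h1
  have hderle : ∀ s : ℝ, ‖fderiv ℝ u (x + s • e) e‖ₑ ≤ ‖fderiv ℝ u (x + s • e)‖ₑ := by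
    intro s
    have h := (fderiv ℝ u (x + s • e)).le_opNorm e
    rw [he, mul_one] at h
    exact enorm_le_iff_norm_le.mpr h
  have hmono : ∫⁻ s in Set.Ioc 0 r₀, ‖fderiv ℝ u (x + s • e) e‖ₑ ≤ ∫⁻ s in Set.Ioi (0 : ℝ),
      {y | A < |u y|}.indicator (fun y => ‖fderiv ℝ u y‖ₑ) (x + s • e) := by
    rw [setLIntegral_congr Ioo_ae_eq_Ioc.symm]
    refine le_trans (setLIntegral_mono' measurableSet_Ioo fun s hs => ?_)
      (lintegral_mono_set fun s hs => hs.1)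
    have hmem : x + s • e ∈ {y | A < |u y|} := by
      by_contra hcon
      exact absurd (hmin s ⟨hs.1.le, le_of_not_gt (a := |u (x + s • e)|) hcon⟩) (not_le.mpr hs.2)
    rw [Set.indicator_of_mem hmem]
    exact hderle s
  refine le_trans ?_ hmono
  by_cases htop : ∫⁻ s in Set.Ioc 0 r₀, ‖fderiv ℝ u (x + s • e) e‖ₑ = ∞
  · rw [htop]
    exact le_top
  have hmeas : Measurable fun s : ℝ => fderiv ℝ u (x + s • e) e := by
    have : (fun s : ℝ => fderiv ℝ u (x + s • e) e) = deriv (fun s : ℝ => u (x + s • e)) := by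
      funext s
      exact (hder s).deriv.symm
    rw [this]
    exact measurable_deriv _
  have hintg : IntervalIntegrable (fun s : ℝ => fderiv ℝ u (x + s • e) e) volume 0 r₀ := by
    rw [intervalIntegrable_iff_integrableOn_Ioc_of_le hr₀0]
    exact ⟨hmeas.aestronglyMeasurable, lt_top_iff_ne_top.mpr htop⟩
  have hftc := intervalIntegral.integral_eq_sub_of_hasDerivAt (fun s _ => hder s) hintg
  rw [intervalIntegral.integral_of_le hr₀0] at hftc
  refine le_trans ?_ (enorm_integral_le_lintegral_enorm _)
  rw [hftc, ← ofReal_norm]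
  refine ENNReal.ofReal_le_ofReal ?_
  simp only [zero_smul, add_zero, Real.norm_eq_abs]
  have := abs_sub_abs_le_abs_sub (u x) (u (x + r₀ • e))
  rw [abs_sub_comm] at this
  linarith

/-- The potential estimate `2π (|u(x)| - A) ≤ ∫_{|u| > A} |∇u(y)| / |x - y| dy`. -/
lemma ofReal_sub_le_lintegral_potential {u : Plane → ℝ} (hu : Differentiable ℝ u) {A : ℝ}
    (hfin : volume {y | A < |u y|} ≠ ∞) (x : Plane) :
    ENNReal.ofReal (2 * π * (|u x| - A)) ≤
      ∫⁻ y in {y | A < |u y|}, ‖fderiv ℝ u y‖ₑ * (ENNReal.ofReal ‖x - y‖)⁻¹ := by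
  set Ω : Set Plane := {y | A < |u y|} with hΩ
  have hΩm : MeasurableSet Ω :=
    (isOpen_lt continuous_const hu.continuous.abs).measurableSet
  have hnorm : ∀ (θ r : ℝ), 0 < r → ‖x - (x + r • unitVec θ)‖ = r := by
    intro θ r hr
    rw [sub_add_cancel_left, norm_neg, norm_smul, norm_unitVec, mul_one, Real.norm_eq_abs,
      abs_of_pos hr]
  have hgm : Measurable fun y => ‖fderiv ℝ u y‖ₑ := (measurable_fderiv ℝ u).enorm
  have hGm : Measurable fun y => ‖fderiv ℝ u y‖ₑ * (ENNReal.ofReal ‖x - y‖)⁻¹ :=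
    hgm.mul (by fun_prop)
  rw [← lintegral_indicator hΩm, lintegral_polar x (hGm.indicator hΩm)]
  have hexit : ∀ᵐ θ ∂(volume.restrict (Set.Ioo (-π) π)),
      ∃ r : ℝ, 0 ≤ r ∧ |u (x + r • unitVec θ)| ≤ A := by
    have h1 : ∫⁻ θ in Set.Ioo (-π) π, ∫⁻ r in Set.Ioi (0 : ℝ),
        ENNReal.ofReal r * Ω.indicator 1 (x + r • unitVec θ) ≠ ∞ := by
      rw [← lintegral_polar x (measurable_one.indicator hΩm), lintegral_indicator_one hΩm]
      exact hfin
    have hm : Measurable fun θ : ℝ => ∫⁻ r in Set.Ioi (0 : ℝ),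
        ENNReal.ofReal r * Ω.indicator 1 (x + r • unitVec θ) := by
      refine Measurable.lintegral_prod_right'
        (f := fun p : ℝ × ℝ => ENNReal.ofReal p.2 * Ω.indicator 1 (x + p.2 • unitVec p.1)) ?_
      have := continuous_unitVec
      refine (ENNReal.measurable_ofReal.comp measurable_snd).mul
        ((measurable_one.indicator hΩm).comp (Continuous.measurable (by fun_prop)))
    filter_upwards [ae_lt_top hm h1] with θ hθ
    by_contra! hcon
    refine absurd hθ (not_lt.mpr (top_le_iff.mpr ?_).ge)
    rw [← top_le_iff]
    calc (∞ : ℝ≥0∞) = ∫⁻ r in Set.Ioi (1 : ℝ), 1 := by simp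
      _ ≤ ∫⁻ r in Set.Ioi (1 : ℝ),
          ENNReal.ofReal r * Ω.indicator 1 (x + r • unitVec θ) := by
        refine setLIntegral_mono' measurableSet_Ioi fun r hr => ?_
        have hr1 : (1 : ℝ) < r := hr
        have hmem : x + r • unitVec θ ∈ Ω := hcon r (by linarith)
        rw [Set.indicator_of_mem hmem, Pi.one_apply, mul_one, ← ENNReal.ofReal_one]
        exact ENNReal.ofReal_le_ofReal hr1.le
      _ ≤ _ := lintegral_mono_set (Set.Ioi_subset_Ioi zero_le_one)
  calc ENNReal.ofReal (2 * π * (|u x| - A))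
      = ∫⁻ θ in Set.Ioo (-π) π, ENNReal.ofReal (|u x| - A) := by
        rw [setLIntegral_const, Real.volume_Ioo,
          ← ENNReal.ofReal_mul' (by linarith [pi_pos])]
        congr 1
        ring
    _ ≤ _ := by
      refine lintegral_mono_ae ?_
      filter_upwards [hexit] with θ ⟨r, hr, hrA⟩
      refine (ofReal_sub_le_lintegral_ray hu x _ (norm_unitVec θ) hr hrA).trans ?_
      refine setLIntegral_mono' measurableSet_Ioi fun s hs => ?_
      have hs0 : (0 : ℝ) < s := hs
      by_cases hmem : x + s • unitVec θ ∈ Ω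
      · rw [Set.indicator_of_mem hmem, Set.indicator_of_mem hmem, hnorm θ s hs0,
          mul_left_comm, ENNReal.mul_inv_cancel (by simpa using hs0) ENNReal.ofReal_ne_top, mul_one]
      · rw [Set.indicator_of_notMem hmem]
        exact zero_le
/-- The kernel `1 / r` cut off to `r < R`. -/
def nearKernel (R r : ℝ) : ℝ≥0∞ := (Set.Iio R).indicator (fun r => (ENNReal.ofReal r)⁻¹) r

lemma measurable_nearKernel (R : ℝ) : Measurable (nearKernel R) :=
  (by fun_prop : Measurable fun r : ℝ => (ENNReal.ofReal r)⁻¹).indicator measurableSet_Iio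

lemma lintegral_nearKernel_le (R : ℝ) (x : Plane) :
    ∫⁻ y, nearKernel R ‖x - y‖ ≤ ENNReal.ofReal (2 * π * R) := by
  rw [lintegral_radial x (measurable_nearKernel R),
    ENNReal.ofReal_mul (by positivity : (0 : ℝ) ≤ 2 * π)]
  gcongr
  calc ∫⁻ r in Set.Ioi (0 : ℝ), ENNReal.ofReal r * nearKernel R r
      ≤ ∫⁻ r in Set.Ioi (0 : ℝ), (Set.Ioo 0 R).indicator 1 r := by
        refine setLIntegral_mono' measurableSet_Ioi fun r hr => ?_
        have hr0 : (0 : ℝ) < r := hr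
        by_cases h : r < R
        · rw [nearKernel, Set.indicator_of_mem (show r ∈ Set.Iio R from h),
            Set.indicator_of_mem (show r ∈ Set.Ioo 0 R from ⟨hr0, h⟩),
            ENNReal.mul_inv_cancel (by simpa using hr0) ENNReal.ofReal_ne_top, Pi.one_apply]
        · rw [nearKernel, Set.indicator_of_notMem (show r ∉ Set.Iio R from h), mul_zero]
          exact zero_le
    _ ≤ ∫⁻ r, (Set.Ioo 0 R).indicator 1 r := setLIntegral_le_lintegral _ _
    _ = ENNReal.ofReal R := by
      rw [lintegral_indicator_one measurableSet_Ioo, Real.volume_Ioo, sub_zero]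

/-- The integral of `1 / |x - y|²` over an annulus. -/
lemma lintegral_annulus_inv_sq_le {R ρ : ℝ} (hR : 0 < R) (hRρ : R ≤ ρ) (x : Plane) :
    ∫⁻ y in {y | R ≤ ‖x - y‖ ∧ ‖x - y‖ < ρ}, (ENNReal.ofReal ‖x - y‖)⁻¹ ^ 2 ≤
      ENNReal.ofReal (2 * π * Real.log (ρ / R)) := by
  have hS : MeasurableSet {y : Plane | R ≤ ‖x - y‖ ∧ ‖x - y‖ < ρ} :=
    (measurableSet_Ico : MeasurableSet (Set.Ico R ρ)).preimage
      (by fun_prop : Measurable fun y : Plane => ‖x - y‖)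
  have hm : Measurable ((Set.Ico R ρ).indicator fun r : ℝ => (ENNReal.ofReal r)⁻¹ ^ 2) :=
    (by fun_prop : Measurable fun r : ℝ => (ENNReal.ofReal r)⁻¹ ^ 2).indicator measurableSet_Ico
  have h1 : ∫⁻ y in {y | R ≤ ‖x - y‖ ∧ ‖x - y‖ < ρ}, (ENNReal.ofReal ‖x - y‖)⁻¹ ^ 2 =
      ∫⁻ y, (Set.Ico R ρ).indicator (fun r : ℝ => (ENNReal.ofReal r)⁻¹ ^ 2) ‖x - y‖ := by
    rw [← lintegral_indicator hS]
    rfl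
  rw [h1, lintegral_radial x hm, ENNReal.ofReal_mul (by positivity : (0 : ℝ) ≤ 2 * π)]
  gcongr
  have hlog : ∫⁻ r in Set.Ico R ρ, ENNReal.ofReal r⁻¹ = ENNReal.ofReal (Real.log (ρ / R)) := by
    rw [← integral_inv_of_pos hR (hR.trans_le hRρ), intervalIntegral.integral_of_le hRρ,
      setLIntegral_congr Ico_ae_eq_Ioc, ofReal_integral_eq_lintegral_ofReal]
    · have : IntervalIntegrable (fun r : ℝ => r⁻¹) volume R ρ := by
        refine intervalIntegral.intervalIntegrable_inv (fun r hr => ?_) continuousOn_id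
        rw [Set.uIcc_of_le hRρ] at hr
        exact (hR.trans_le hr.1).ne'
      exact (intervalIntegrable_iff_integrableOn_Ioc_of_le hRρ).mp this
    · filter_upwards [ae_restrict_mem measurableSet_Ioc] with r hr
      exact inv_nonneg.mpr (hR.trans hr.1).le
  rw [← hlog, ← lintegral_indicator measurableSet_Ico]
  refine (setLIntegral_mono' measurableSet_Ioi fun r hr => ?_).trans (setLIntegral_le_lintegral _ _)
  have hr0 : (0 : ℝ) < r := hr
  by_cases h : r ∈ Set.Ico R ρ
  · rw [Set.indicator_of_mem h, Set.indicator_of_mem h, ENNReal.ofReal_inv_of_pos hr0, pow_two,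
      ← mul_assoc, ENNReal.mul_inv_cancel (by simpa using hr0) ENNReal.ofReal_ne_top, one_mul]
  · rw [Set.indicator_of_notMem h, mul_zero]
    exact zero_le

/-- The integral of `1 / |x - y|²` outside a disc, with respect to a measure dominated by Lebesgue
measure whose total mass is at most that of a disc of radius `ρ`. -/
lemma lintegral_compl_ball_inv_sq_le {ν : Measure Plane} (hν : ν ≤ volume) {R ρ : ℝ} (hR : 0 < R)
    (hRρ : R ≤ ρ) (hmass : ν Set.univ ≤ ENNReal.ofReal (π * ρ ^ 2)) (x : Plane) :
    ∫⁻ y in {y | R ≤ ‖x - y‖}, (ENNReal.ofReal ‖x - y‖)⁻¹ ^ 2 ∂ν ≤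
      ENNReal.ofReal (π * (2 * Real.log (ρ / R) + 1)) := by
  have hρ : 0 < ρ := hR.trans_le hRρ
  have hsub : {y : Plane | R ≤ ‖x - y‖} ⊆
      {y | R ≤ ‖x - y‖ ∧ ‖x - y‖ < ρ} ∪ {y | ρ ≤ ‖x - y‖} := fun y hy =>
    (lt_or_ge ‖x - y‖ ρ).imp (fun h => ⟨hy, h⟩) id
  have h1 : ∫⁻ y in {y | ρ ≤ ‖x - y‖}, (ENNReal.ofReal ‖x - y‖)⁻¹ ^ 2 ∂ν ≤ ENNReal.ofReal π := by
    calc _ ≤ ∫⁻ y in {y | ρ ≤ ‖x - y‖}, (ENNReal.ofReal ρ)⁻¹ ^ 2 ∂ν := by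
          refine setLIntegral_mono measurable_const fun y hy => ?_
          have hy' : ρ ≤ ‖x - y‖ := hy
          gcongr
      _ ≤ (ENNReal.ofReal ρ)⁻¹ ^ 2 * ENNReal.ofReal (π * ρ ^ 2) := by
          rw [setLIntegral_const]
          gcongr
          exact (measure_mono (Set.subset_univ _)).trans hmass
      _ = ENNReal.ofReal π := by
          rw [← ENNReal.ofReal_inv_of_pos hρ, ← ENNReal.ofReal_pow (by positivity),
            ← ENNReal.ofReal_mul (by positivity)]
          congr 1
          field_simp
  calc _ ≤ _ := lintegral_mono_set hsub
    _ ≤ _ := lintegral_union_le _ _ _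
    _ ≤ ENNReal.ofReal (2 * π * Real.log (ρ / R)) + ENNReal.ofReal π := by
        refine add_le_add (le_trans ?_ (lintegral_annulus_inv_sq_le hR hRρ x)) h1
        exact lintegral_mono' (Measure.restrict_mono_measure hν _) le_rfl
    _ = _ := by
        rw [← ENNReal.ofReal_add]
        · congr 1
          ring
        · have := Real.log_nonneg ((one_le_div hR).mpr hRρ)
          positivity
        · positivity

/-- The Cauchy–Schwarz inequality with real bounds. -/
lemma lintegral_mul_le_sqrt_mul_sqrt {α : Type*} [MeasurableSpace α] (ν : Measure α)
    {φ ψ : α → ℝ≥0∞} (hφ : AEMeasurable φ ν) (hψ : AEMeasurable ψ ν) {a b : ℝ}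
    (ha : 0 ≤ a) (hb : 0 ≤ b) (hφa : ∫⁻ y, φ y ^ 2 ∂ν ≤ ENNReal.ofReal a)
    (hψb : ∫⁻ y, ψ y ^ 2 ∂ν ≤ ENNReal.ofReal b) :
    ∫⁻ y, φ y * ψ y ∂ν ≤ ENNReal.ofReal (√a * √b) := by
  have h := ENNReal.lintegral_mul_le_Lp_mul_Lq ν Real.HolderConjugate.two_two hφ hψ
  simp only [ENNReal.rpow_two, Pi.mul_apply] at h
  refine h.trans ?_
  rw [ENNReal.ofReal_mul (Real.sqrt_nonneg a), Real.sqrt_eq_rpow, Real.sqrt_eq_rpow,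
    ← ENNReal.ofReal_rpow_of_nonneg ha (by norm_num),
    ← ENNReal.ofReal_rpow_of_nonneg hb (by norm_num)]
  gcongr
lemma lintegral_weight_mul_mul_le {α : Type*} [MeasurableSpace α] (ν : Measure α)
    {w φ ψ : α → ℝ≥0∞} (hw : Measurable w) (hφ : Measurable φ) (hψ : Measurable ψ) {a b : ℝ}
    (ha : 0 ≤ a) (hb : 0 ≤ b) (hφa : ∫⁻ y, w y * φ y ^ 2 ∂ν ≤ ENNReal.ofReal a)
    (hψb : ∫⁻ y, w y * ψ y ^ 2 ∂ν ≤ ENNReal.ofReal b) :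
    ∫⁻ y, w y * (φ y * ψ y) ∂ν ≤ ENNReal.ofReal (√a * √b) := by
  have h := lintegral_mul_le_sqrt_mul_sqrt (ν.withDensity w) hφ.aemeasurable hψ.aemeasurable ha hb
    (by rwa [lintegral_withDensity_eq_lintegral_mul ν hw (hφ.pow_const 2)])
    (by rwa [lintegral_withDensity_eq_lintegral_mul ν hw (hψ.pow_const 2)])
  rwa [lintegral_withDensity_eq_lintegral_mul ν hw (hφ.fun_mul hψ)] at h

/-- The near part of the potential, averaged over `E`, is controlled by the mass of `g ^ 2` against
a weight that is bounded by `1` and has the same total mass as `E`. -/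
lemma exists_weight_near {ν : Measure Plane} [SFinite ν] (hν : ν ≤ volume) {g : Plane → ℝ≥0∞}
    (hg : Measurable g) {E : Set Plane} {R : ℝ} (hR : 0 < R)
    (hEm : volume E = ENNReal.ofReal (π * R ^ 2)) :
    ∃ ψ : Plane → ℝ≥0∞, Measurable ψ ∧ (∀ y, ψ y ≤ 1) ∧
      ∫⁻ y, ψ y ∂ν ≤ ENNReal.ofReal (π * R ^ 2) ∧
      ∀ l : ℝ, 0 ≤ l → ∫⁻ y, ψ y * g y ^ 2 ∂ν ≤ ENNReal.ofReal l →
        ∫⁻ x in E, ∫⁻ y, g y * nearKernel R ‖x - y‖ ∂ν ≤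
          ENNReal.ofReal (π * R ^ 2) * ENNReal.ofReal (2 * √π * √l) := by
  have hNm : Measurable fun p : Plane × Plane => nearKernel R ‖p.1 - p.2‖ :=
    (measurable_nearKernel R).comp (by fun_prop)
  have hc0 : ENNReal.ofReal (2 * π * R) ≠ 0 := by
    simp only [ne_eq, ENNReal.ofReal_eq_zero, not_le]
    positivity
  set c := ENNReal.ofReal (2 * π * R) with hc
  have hctop : c ≠ ∞ := ENNReal.ofReal_ne_top
  set j : Plane → ℝ≥0∞ := fun y => ∫⁻ x in E, nearKernel R ‖x - y‖ with hj
  have hjm : Measurable j :=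
    Measurable.lintegral_prod_left' (f := fun p : Plane × Plane => nearKernel R ‖p.1 - p.2‖) hNm
  have hjc : ∀ y, j y ≤ c := fun y => by
    refine (setLIntegral_le_lintegral _ _).trans ?_
    simpa only [norm_sub_rev] using lintegral_nearKernel_le R y
  have hjint : ∫⁻ y, j y ∂ν ≤ c * ENNReal.ofReal (π * R ^ 2) := by
    calc ∫⁻ y, j y ∂ν ≤ ∫⁻ y, j y := lintegral_mono' hν le_rfl
      _ = ∫⁻ x in E, ∫⁻ y, nearKernel R ‖x - y‖ :=
        lintegral_lintegral_swap (hNm.comp measurable_swap).aemeasurable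
      _ ≤ ∫⁻ _ in E, c := lintegral_mono fun x => lintegral_nearKernel_le R x
      _ = _ := by rw [setLIntegral_const, hEm]
  have hψm : Measurable fun y => c⁻¹ * j y := hjm.const_mul _
  have hψint : ∫⁻ y, c⁻¹ * j y ∂ν ≤ ENNReal.ofReal (π * R ^ 2) := by
    rw [lintegral_const_mul _ hjm]
    calc _ ≤ c⁻¹ * (c * ENNReal.ofReal (π * R ^ 2)) := by gcongr
      _ = _ := by rw [← mul_assoc, ENNReal.inv_mul_cancel hc0 hctop, one_mul]
  refine ⟨fun y => c⁻¹ * j y, hψm, fun y => ?_, hψint, fun l hl hgl => ?_⟩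
  · calc c⁻¹ * j y ≤ c⁻¹ * c := by gcongr; exact hjc y
      _ = 1 := ENNReal.inv_mul_cancel hc0 hctop
  · have hCS := lintegral_weight_mul_mul_le ν hψm hg (measurable_const (a := (1 : ℝ≥0∞)))
      (b := π * R ^ 2) hl (by positivity) hgl (by simpa using hψint)
    calc ∫⁻ x in E, ∫⁻ y, g y * nearKernel R ‖x - y‖ ∂ν
        = ∫⁻ y, (∫⁻ x in E, g y * nearKernel R ‖x - y‖) ∂ν :=
          lintegral_lintegral_swap ((hg.comp measurable_snd).fun_mul hNm).aemeasurable
      _ = ∫⁻ y, c * (c⁻¹ * j y * (g y * 1)) ∂ν := by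
          refine lintegral_congr fun y => ?_
          have hNy : Measurable fun x : Plane => nearKernel R ‖x - y‖ :=
            (measurable_nearKernel R).comp (by fun_prop)
          rw [lintegral_const_mul _ hNy, mul_one, ← mul_assoc, ← mul_assoc,
            ENNReal.mul_inv_cancel hc0 hctop, one_mul,
            mul_comm]
      _ = c * ∫⁻ y, c⁻¹ * j y * (g y * 1) ∂ν :=
          lintegral_const_mul _ (hψm.fun_mul (hg.mul_const 1))
      _ ≤ c * ENNReal.ofReal (√l * √(π * R ^ 2)) := by gcongr
      _ = _ := by
          rw [hc, ← ENNReal.ofReal_mul (by positivity), ← ENNReal.ofReal_mul (by positivity),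
            Real.sqrt_mul pi_pos.le, Real.sqrt_sq hR.le]
          congr 1
          ring

lemma lintegral_potential_eq_add {ν : Measure Plane} {g : Plane → ℝ≥0∞} (R : ℝ) (x : Plane) :
    ∫⁻ y, g y * (ENNReal.ofReal ‖x - y‖)⁻¹ ∂ν =
      ∫⁻ y in {y | R ≤ ‖x - y‖}, g y * (ENNReal.ofReal ‖x - y‖)⁻¹ ∂ν +
        ∫⁻ y, g y * nearKernel R ‖x - y‖ ∂ν := by
  have hS : MeasurableSet {y : Plane | R ≤ ‖x - y‖} :=
    measurableSet_le measurable_const (by fun_prop)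
  rw [← lintegral_add_compl _ hS]
  congr 1
  rw [← lintegral_indicator hS.compl]
  refine lintegral_congr fun y => ?_
  by_cases h : ‖x - y‖ < R
  · rw [Set.indicator_of_mem (show y ∈ {y | R ≤ ‖x - y‖}ᶜ from not_le.mpr h), nearKernel,
      Set.indicator_of_mem (show ‖x - y‖ ∈ Set.Iio R from h)]
  · rw [Set.indicator_of_notMem (fun hy => h (not_le.mp hy)), nearKernel,
      Set.indicator_of_notMem (show ‖x - y‖ ∉ Set.Iio R from h), mul_zero]

lemma le_add_of_average_le {E : Set Plane} (hE : MeasurableSet E) {m s a b : ℝ} (hm : 0 < m)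
    (ha : 0 ≤ a) (hb : 0 ≤ b)
    (hEm : volume E = ENNReal.ofReal m) {G : Plane → ℝ≥0∞}
    (hG : ∀ x ∈ E, ENNReal.ofReal s ≤ ENNReal.ofReal a + G x)
    (hGE : ∫⁻ x in E, G x ≤ ENNReal.ofReal m * ENNReal.ofReal b) : s ≤ a + b := by
  have h : ENNReal.ofReal m * ENNReal.ofReal s ≤ ENNReal.ofReal m * ENNReal.ofReal (a + b) := by
    calc ENNReal.ofReal m * ENNReal.ofReal s = ∫⁻ _ in E, ENNReal.ofReal s := by
          rw [setLIntegral_const, hEm, mul_comm]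
      _ ≤ ∫⁻ x in E, (ENNReal.ofReal a + G x) := setLIntegral_mono' hE hG
      _ = ENNReal.ofReal m * ENNReal.ofReal a + ∫⁻ x in E, G x := by
          rw [lintegral_add_left measurable_const, setLIntegral_const, hEm, mul_comm]
      _ ≤ ENNReal.ofReal m * ENNReal.ofReal a + ENNReal.ofReal m * ENNReal.ofReal b := by gcongr
      _ = _ := by rw [← mul_add, ENNReal.ofReal_add ha hb]
  rw [← ENNReal.ofReal_mul hm.le, ← ENNReal.ofReal_mul hm.le,
    ENNReal.ofReal_le_ofReal_iff (by positivity)] at h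
  exact le_of_mul_le_mul_left h hm

/-- The estimate at one scale: a level set of radius `R` on which the potential is at least
`2 π s` limits both `s` and the concentration of `g ^ 2` on sets of the same measure. -/
lemma level_le_of_weight {ν : Measure Plane} [SFinite ν] (hν : ν ≤ volume) {g : Plane → ℝ≥0∞}
    (hg : Measurable g) (hg1 : ∫⁻ y, g y ^ 2 ∂ν ≤ 1) {R ρ : ℝ} (hR : 0 < R) (hRρ : R ≤ ρ)
    (hmass : ν Set.univ ≤ ENNReal.ofReal (π * ρ ^ 2)) {E : Set Plane} (hE : MeasurableSet E)
    (hEm : volume E = ENNReal.ofReal (π * R ^ 2)) {s : ℝ}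
    (hs : ∀ x ∈ E, ENNReal.ofReal (2 * π * s) ≤ ∫⁻ y, g y * (ENNReal.ofReal ‖x - y‖)⁻¹ ∂ν)
    {χ : Plane → ℝ≥0∞} (hχ : Measurable χ) (hχ1 : ∀ y, χ y ≤ 1)
    (hχint : ∫⁻ y, χ y ∂ν ≤ ENNReal.ofReal (π * R ^ 2)) :
    ∃ l : ℝ, 0 ≤ l ∧ l ≤ 1 ∧ ∫⁻ y, χ y * g y ^ 2 ∂ν ≤ ENNReal.ofReal (2 * l) ∧
      2 * √π * s ≤ √((1 - l) * (2 * Real.log (ρ / R) + 1)) + 4 * √l := by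
  obtain ⟨η, hη, hη1, hηint, hηE⟩ := exists_weight_near hν hg hR hEm
  set ψ : Plane → ℝ≥0∞ := fun y => 2⁻¹ * (χ y + η y) with hψdef
  have hψ : Measurable ψ := (hχ.fun_add hη).const_mul _
  have hψ' : Measurable fun y => 1 - ψ y := measurable_const.fun_sub hψ
  have hψg : Measurable fun y => ψ y * g y ^ 2 := hψ.fun_mul (hg.pow_const 2)
  have hψ1 : ∀ y, ψ y ≤ 1 := fun y => by
    calc ψ y ≤ 2⁻¹ * (1 + 1) := by
          simp only [hψdef]
          gcongr
          · exact hχ1 y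
          · exact hη1 y
      _ = 1 := by
          rw [one_add_one_eq_two]
          exact ENNReal.inv_mul_cancel (by simp) (by simp)
  have h2ψ : ∀ y, 2 * ψ y = χ y + η y := fun y => by
    rw [hψdef, ← mul_assoc, ENNReal.mul_inv_cancel (by simp) (by simp), one_mul]
  have hψint : ∫⁻ y, ψ y ∂ν ≤ ENNReal.ofReal (π * R ^ 2) := by
    calc _ = 2⁻¹ * (∫⁻ y, χ y ∂ν + ∫⁻ y, η y ∂ν) := by
          rw [← lintegral_add_left hχ, ← lintegral_const_mul _ (hχ.fun_add hη)]
      _ ≤ 2⁻¹ * (ENNReal.ofReal (π * R ^ 2) + ENNReal.ofReal (π * R ^ 2)) := by gcongr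
      _ = _ := by
        rw [← two_mul, ← mul_assoc, ENNReal.inv_mul_cancel (by simp) (by simp), one_mul]
  have hsum : ∫⁻ y, (1 - ψ y) * g y ^ 2 ∂ν + ∫⁻ y, ψ y * g y ^ 2 ∂ν ≤ 1 := by
    rw [← lintegral_add_right _ hψg]
    refine le_trans (lintegral_mono fun y => ?_) hg1
    rw [← add_mul, tsub_add_cancel_of_le (hψ1 y), one_mul]
  have hLtop : ∫⁻ y, ψ y * g y ^ 2 ∂ν ≠ ∞ :=
    ne_top_of_le_ne_top ENNReal.one_ne_top (le_add_self.trans hsum)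
  obtain ⟨l, hl0, hl⟩ : ∃ l : ℝ, 0 ≤ l ∧ ∫⁻ y, ψ y * g y ^ 2 ∂ν = ENNReal.ofReal l :=
    ⟨_, ENNReal.toReal_nonneg, (ENNReal.ofReal_toReal hLtop).symm⟩
  have hl1 : l ≤ 1 := by
    rw [← ENNReal.ofReal_le_one, ← hl]
    exact le_add_self.trans hsum
  have hcompl : ∫⁻ y, (1 - ψ y) * g y ^ 2 ∂ν ≤ ENNReal.ofReal (1 - l) := by
    rw [ENNReal.ofReal_sub _ hl0, ENNReal.ofReal_one, ← hl]
    exact ENNReal.le_sub_of_add_le_right hLtop hsum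
  have hweight : ∀ χ' : Plane → ℝ≥0∞, (∀ y, χ' y ≤ 2 * ψ y) →
      ∫⁻ y, χ' y * g y ^ 2 ∂ν ≤ ENNReal.ofReal (2 * l) := fun χ' h => by
    calc _ ≤ ∫⁻ y, 2 * (ψ y * g y ^ 2) ∂ν := lintegral_mono fun y => by
          rw [← mul_assoc]
          gcongr
          exact h y
      _ = _ := by
        rw [lintegral_const_mul _ hψg, hl, ENNReal.ofReal_mul zero_le_two,
          ENNReal.ofReal_ofNat]
  have ht : 0 ≤ 2 * Real.log (ρ / R) + 1 := by
    have := Real.log_nonneg ((one_le_div hR).mpr hRρ)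
    positivity
  refine ⟨l, hl0, hl1, hweight χ fun y => (h2ψ y).symm ▸ le_self_add, ?_⟩
  have hnear := hηE (2 * l) (by positivity) (hweight η fun y => (h2ψ y).symm ▸ le_add_self)
  have hfar : ∀ x : Plane, ∫⁻ y in {y | R ≤ ‖x - y‖}, g y * (ENNReal.ofReal ‖x - y‖)⁻¹ ∂ν ≤
      ENNReal.ofReal (√(1 - l) * √(π * (2 * Real.log (ρ / R) + 1)) + √l * √π) := fun x => by
    have hKm : Measurable fun y : Plane => (ENNReal.ofReal ‖x - y‖)⁻¹ := by fun_prop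
    have h1 := lintegral_weight_mul_mul_le (ν.restrict {y | R ≤ ‖x - y‖}) hψ' hg hKm
      (sub_nonneg.mpr hl1) (mul_nonneg pi_pos.le ht) ((setLIntegral_le_lintegral _ _).trans hcompl)
      (le_trans (lintegral_mono fun y => by
        calc _ ≤ 1 * (ENNReal.ofReal ‖x - y‖)⁻¹ ^ 2 := by
              gcongr
              exact tsub_le_self
          _ = _ := one_mul _) (lintegral_compl_ball_inv_sq_le hν hR hRρ hmass x))
    have h2 := lintegral_weight_mul_mul_le (ν.restrict {y | R ≤ ‖x - y‖}) hψ hg hKm hl0 pi_pos.le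
      ((setLIntegral_le_lintegral _ _).trans hl.le) (by
        calc ∫⁻ y in {y | R ≤ ‖x - y‖}, ψ y * (ENNReal.ofReal ‖x - y‖)⁻¹ ^ 2 ∂ν
            ≤ ∫⁻ y in {y | R ≤ ‖x - y‖}, ψ y * (ENNReal.ofReal R)⁻¹ ^ 2 ∂ν := by
              refine setLIntegral_mono (hψ.mul_const _) fun y hy => ?_
              have hy' : R ≤ ‖x - y‖ := hy
              gcongr
          _ ≤ ∫⁻ y, ψ y * (ENNReal.ofReal R)⁻¹ ^ 2 ∂ν := setLIntegral_le_lintegral _ _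
          _ = (∫⁻ y, ψ y ∂ν) * (ENNReal.ofReal R)⁻¹ ^ 2 := lintegral_mul_const _ hψ
          _ ≤ ENNReal.ofReal (π * R ^ 2) * (ENNReal.ofReal R)⁻¹ ^ 2 := by gcongr
          _ = ENNReal.ofReal π := by
            rw [← ENNReal.ofReal_inv_of_pos hR, ← ENNReal.ofReal_pow (by positivity),
              ← ENNReal.ofReal_mul (by positivity)]
            congr 1
            field_simp)
    rw [ENNReal.ofReal_add (by positivity) (by positivity)]
    refine le_trans (le_of_eq ?_) (add_le_add h1 h2)
    rw [← lintegral_add_right _ (hψ.fun_mul (hg.fun_mul hKm))]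
    refine lintegral_congr fun y => ?_
    rw [← add_mul, tsub_add_cancel_of_le (hψ1 y), one_mul]
  have hmain := le_add_of_average_le hE (by positivity) (by positivity) (by positivity) hEm
    (fun x hx => (hs x hx).trans ((lintegral_potential_eq_add R x).le.trans
      (add_le_add_left (hfar x) _))) hnear
  have hπ : √π * √π = π := Real.mul_self_sqrt pi_pos.le
  have hπ0 : 0 < √π := Real.sqrt_pos.mpr pi_pos
  rw [Real.sqrt_mul (sub_nonneg.mpr hl1)]
  rw [Real.sqrt_mul pi_pos.le, Real.sqrt_mul zero_le_two] at hmain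
  have h2 : √2 ≤ 3 / 2 := by
    rw [Real.sqrt_le_left (by norm_num)]
    norm_num
  refine le_of_mul_le_mul_left ?_ hπ0
  have h3 := mul_le_mul_of_nonneg_left h2 (mul_nonneg hπ0.le (Real.sqrt_nonneg l))
  calc √π * (2 * √π * s) = 2 * (√π * √π) * s := by ring
    _ = 2 * π * s := by rw [hπ]
    _ ≤ _ := hmain
    _ ≤ _ := by linarith

/-- The estimate at two scales: if the square mass of `g` on discs of radius `R₁` is at most `ε`,
then passing to a smaller level set of radius `R₂` increases the level only a little. -/
lemma level_le_of_concentration {ν : Measure Plane} [SFinite ν] (hν : ν ≤ volume)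
    {g : Plane → ℝ≥0∞} (hg : Measurable g) (hg1 : ∫⁻ y, g y ^ 2 ∂ν ≤ 1) {R₁ R₂ ρ : ℝ}
    (hR₂ : 0 < R₂) (hR : R₂ ≤ R₁) (hRρ : R₁ ≤ ρ)
    (hmass : ν Set.univ ≤ ENNReal.ofReal (π * ρ ^ 2)) {E : Set Plane} (hE : MeasurableSet E)
    (hEm : volume E = ENNReal.ofReal (π * R₂ ^ 2)) {s : ℝ}
    (hs : ∀ x ∈ E, ENNReal.ofReal (2 * π * s) ≤ ∫⁻ y, g y * (ENNReal.ofReal ‖x - y‖)⁻¹ ∂ν)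
    {ε : ℝ} (hε : 0 ≤ ε) (hgε : ∀ χ : Plane → ℝ≥0∞, Measurable χ → (∀ y, χ y ≤ 1) →
      ∫⁻ y, χ y ∂ν ≤ ENNReal.ofReal (π * R₁ ^ 2) → ∫⁻ y, χ y * g y ^ 2 ∂ν ≤ ENNReal.ofReal ε) :
    2 * √π * s ≤ √(2 * Real.log (ρ / R₁) + 1) + √ε * (√(2 * Real.log (R₁ / R₂)) + 2) := by
  have hR₁ : 0 < R₁ := hR₂.trans_le hR
  obtain ⟨η, hη, hη1, hηint, hηE⟩ := exists_weight_near hν hg hR₂ hEm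
  have hnear := hηE ε hε (hgε η hη hη1 (hηint.trans (ENNReal.ofReal_le_ofReal (by gcongr))))
  have hlog₁ : 0 ≤ Real.log (ρ / R₁) := Real.log_nonneg ((one_le_div hR₁).mpr hRρ)
  have hlog₂ : 0 ≤ Real.log (R₁ / R₂) := Real.log_nonneg ((one_le_div hR₂).mpr hR)
  have hfar : ∀ x : Plane, ∫⁻ y in {y | R₂ ≤ ‖x - y‖}, g y * (ENNReal.ofReal ‖x - y‖)⁻¹ ∂ν ≤
      ENNReal.ofReal (√1 * √(π * (2 * Real.log (ρ / R₁) + 1)) +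
        √ε * √(2 * π * Real.log (R₁ / R₂))) := fun x => by
    have hKm : Measurable fun y : Plane => (ENNReal.ofReal ‖x - y‖)⁻¹ := by fun_prop
    have h1 := lintegral_mul_le_sqrt_mul_sqrt (ν.restrict {y | R₁ ≤ ‖x - y‖}) hg.aemeasurable
      hKm.aemeasurable zero_le_one (by positivity)
      ((setLIntegral_le_lintegral _ _).trans (hg1.trans ENNReal.ofReal_one.ge))
      (lintegral_compl_ball_inv_sq_le hν hR₁ hRρ hmass x)
    have hball : ∫⁻ y in {y | R₂ ≤ ‖x - y‖ ∧ ‖x - y‖ < R₁}, g y ^ 2 ∂ν ≤ ENNReal.ofReal ε := by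
      have hB : MeasurableSet (Metric.ball x R₁) := measurableSet_ball
      refine le_trans ?_ (hgε ((Metric.ball x R₁).indicator 1) (measurable_one.indicator hB)
        (fun y => Set.indicator_le_self' (fun _ _ => zero_le_one) y) ?_)
      · calc _ ≤ ∫⁻ y in Metric.ball x R₁, g y ^ 2 ∂ν :=
              lintegral_mono_set fun y hy => by
                rw [Metric.mem_ball, dist_comm, dist_eq_norm]
                exact hy.2
          _ = _ := by
              rw [← lintegral_indicator hB]
              refine lintegral_congr fun y => ?_
              by_cases h : y ∈ Metric.ball x R₁ <;> simp [h]
      · rw [lintegral_indicator_one hB]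
        refine (hν _).trans ?_
        rw [EuclideanSpace.volume_ball_fin_two, ← ENNReal.ofReal_pow hR₁.le, mul_comm,
          ENNReal.ofReal_mul pi_pos.le]
    have h2 := lintegral_mul_le_sqrt_mul_sqrt (ν.restrict {y | R₂ ≤ ‖x - y‖ ∧ ‖x - y‖ < R₁})
      hg.aemeasurable hKm.aemeasurable hε (by positivity) hball
      ((lintegral_mono' (Measure.restrict_mono_measure hν _) le_rfl).trans
        (lintegral_annulus_inv_sq_le hR₂ hR x))
    rw [ENNReal.ofReal_add (by positivity) (by positivity)]
    refine le_trans ?_ (add_le_add h1 h2)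
    refine (lintegral_mono_set fun y (hy : R₂ ≤ ‖x - y‖) => ?_).trans (lintegral_union_le _ _ _)
    exact (lt_or_ge ‖x - y‖ R₁).symm.imp id fun h => ⟨hy, h⟩
  have hmain := le_add_of_average_le hE (by positivity) (by positivity) (by positivity) hEm
    (fun x hx => (hs x hx).trans ((lintegral_potential_eq_add R₂ x).le.trans
      (add_le_add_left (hfar x) _))) hnear
  have hπ : √π * √π = π := Real.mul_self_sqrt pi_pos.le
  have hπ0 : 0 < √π := Real.sqrt_pos.mpr pi_pos
  rw [Real.sqrt_mul pi_pos.le, Real.sqrt_one, mul_comm 2 π, mul_assoc π 2 (Real.log (R₁ / R₂)),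
    Real.sqrt_mul pi_pos.le] at hmain
  refine le_of_mul_le_mul_left ?_ hπ0
  calc √π * (2 * √π * s) = √π * √π * 2 * s := by ring
    _ = π * 2 * s := by rw [hπ]
    _ ≤ _ := hmain
    _ = _ := by ring
lemma level_bounds_of_sqrt_le {t l σ : ℝ} (ht : 0 ≤ t) (hl0 : 0 ≤ l) (hl1 : l ≤ 1) (hσ : 0 ≤ σ)
    (h : √σ ≤ √((1 - l) * (t + 1)) + 4 * √l) :
    σ ≤ t + 17 ∧ l * (t + 1) ≤ 2 * (t - σ + 49) := by
  have hX : √((1 - l) * (t + 1)) ^ 2 = (1 - l) * (t + 1) :=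
    Real.sq_sqrt (mul_nonneg (sub_nonneg.mpr hl1) (by linarith))
  have hY : √l ^ 2 = l := Real.sq_sqrt hl0
  have hX0 := Real.sqrt_nonneg ((1 - l) * (t + 1))
  have hY0 := Real.sqrt_nonneg l
  set X := √((1 - l) * (t + 1))
  set Y := √l
  have hσ2 : σ ≤ (X + 4 * Y) ^ 2 := by
    rw [← Real.sq_sqrt hσ]
    gcongr
  have hq : 0 ≤ l * (t + 1) := mul_nonneg hl0 (by linarith)
  have hsq : (8 * (X * Y)) ^ 2 = 64 * ((1 - l) * (t + 1)) * l := by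
    rw [mul_pow, mul_pow, hX, hY]
    ring
  have h1 : 8 * (X * Y) ≤ 16 * (1 - l) + l * (t + 1) := by
    refine abs_le_of_sq_le_sq' ?_ (by linarith) |>.2
    rw [hsq]
    nlinarith [sq_nonneg (16 * (1 - l) - l * (t + 1))]
  have h2 : 8 * (X * Y) ≤ l * (t + 1) / 2 + 32 := by
    refine abs_le_of_sq_le_sq' ?_ (by linarith) |>.2
    rw [hsq]
    nlinarith [sq_nonneg (l * (t + 1) / 2 - 32), mul_nonneg hl0 hq]
  constructor <;> nlinarith

lemma sub_le_of_sqrt_le {t₁ t₂ σ Λ : ℝ} (ht₁ : 0 ≤ t₁) (ht : t₁ ≤ t₂) (hσ : 0 ≤ σ) (hΛ : 1 ≤ Λ)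
    (hΛt : 32 * Λ ≤ t₁ + 1) (hσΛ : t₂ - σ + 49 ≤ Λ)
    (h : √σ ≤ √(t₁ + 1) + √(4 * Λ / (t₁ + 1)) * (√(t₂ - t₁) + 2)) : t₂ - t₁ ≤ 52 * Λ := by
  have hP : √(t₁ + 1) ^ 2 = t₁ + 1 := Real.sq_sqrt (by linarith)
  have hQ : √(4 * Λ / (t₁ + 1)) ^ 2 = 4 * Λ / (t₁ + 1) := Real.sq_sqrt (by positivity)
  have hD : √(t₂ - t₁) ^ 2 = t₂ - t₁ := Real.sq_sqrt (by linarith)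
  have hL : √Λ ^ 2 = Λ := Real.sq_sqrt (by linarith)
  have hPQ : √(t₁ + 1) * √(4 * Λ / (t₁ + 1)) = 2 * √Λ := by
    rw [← Real.sqrt_mul (by linarith), mul_div_cancel₀ _ (by linarith : t₁ + 1 ≠ 0),
      Real.sqrt_mul (by norm_num)]
    congr 1
    rw [Real.sqrt_eq_iff_mul_self_eq] <;> norm_num
  have hQ8 : 4 * Λ / (t₁ + 1) ≤ 1 / 8 := by
    rw [div_le_iff₀ (by linarith)]
    linarith
  have hD0 := Real.sqrt_nonneg (t₂ - t₁)
  have hσ2 : σ ≤ (√(t₁ + 1) + √(4 * Λ / (t₁ + 1)) * (√(t₂ - t₁) + 2)) ^ 2 := by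
    conv_lhs => rw [← Real.sq_sqrt hσ]
    gcongr
  have hexp : (√(t₁ + 1) + √(4 * Λ / (t₁ + 1)) * (√(t₂ - t₁) + 2)) ^ 2 =
      (t₁ + 1) + 4 * √Λ * (√(t₂ - t₁) + 2) + 4 * Λ / (t₁ + 1) * (√(t₂ - t₁) + 2) ^ 2 := by
    rw [add_sq, mul_pow, hP, hQ, mul_assoc 2, ← mul_assoc (√(t₁ + 1)), hPQ]
    ring
  rw [hexp] at hσ2
  set D := √(t₂ - t₁)
  have h1 : 4 * Λ / (t₁ + 1) * (D + 2) ^ 2 ≤ 1 / 8 * (D + 2) ^ 2 := by gcongr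
  nlinarith [sq_nonneg (D / 2 - 4 * √Λ), sq_nonneg (√Λ - 1), sq_nonneg (D - 2)]

/-- A universal constant for the exponential integral over a set of measure one. -/
def moserConst : ℝ≥0∞ := ∑' n : ℕ, ENNReal.ofReal (Real.exp (49 - n) * (154 * (n + 1)))

lemma moserConst_ne_top : moserConst ≠ ∞ := by
  have h0 := Real.summable_pow_mul_exp_neg_nat_mul 0 one_pos
  have h1 := Real.summable_pow_mul_exp_neg_nat_mul 1 one_pos
  refine Summable.tsum_ofReal_ne_top (((h0.add h1).mul_left (154 * Real.exp 49)).congr fun n => ?_)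
  rw [sub_eq_add_neg, Real.exp_add, neg_one_mul]
  ring

/-- If `M σ = V e^{-T σ}` where `T σ ≥ σ - 17` and, for each `Λ`, the `σ` with `T σ - σ + 49 ≤ Λ`
that exceed a multiple of `Λ` lie in an interval of length comparable to `Λ`, then
`∫ M σ e^σ dσ` is bounded by a multiple of `V`. -/
lemma lintegral_mul_exp_le {M : ℝ → ℝ≥0∞} {T : ℝ → ℝ} {V : ℝ} (hV : 0 ≤ V)
    (hM : ∀ σ, 0 < σ → M σ ≠ 0 → M σ = ENNReal.ofReal (V * Real.exp (-T σ)) ∧ σ ≤ T σ + 17)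
    (hgap : ∀ σ₁ σ₂ Λ, 0 < σ₁ → σ₁ ≤ σ₂ → M σ₁ ≠ 0 → M σ₂ ≠ 0 → T σ₁ - σ₁ + 49 ≤ Λ →
      T σ₂ - σ₂ + 49 ≤ Λ → 32 * Λ ≤ T σ₁ + 1 → σ₂ - σ₁ ≤ 53 * Λ) :
    ∫⁻ σ in Set.Ioi 0, M σ * ENNReal.ofReal (Real.exp σ) ≤ ENNReal.ofReal V * moserConst := by
  have hex : ∀ n : ℕ, ∃ a : ℝ, ∀ σ, 0 < σ → M σ ≠ 0 → T σ - σ + 49 ≤ n + 1 →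
      32 * ((n : ℝ) + 1) ≤ T σ + 1 →
      σ ∈ Set.Icc (a - 53 * ((n : ℝ) + 1)) (a + 53 * ((n : ℝ) + 1)) := by
    intro n
    by_cases hne : ∃ a : ℝ, 0 < a ∧ M a ≠ 0 ∧ T a - a + 49 ≤ n + 1 ∧ 32 * ((n : ℝ) + 1) ≤ T a + 1
    · obtain ⟨a, ha0, haM, haT, ha32⟩ := hne
      refine ⟨a, fun σ hσ hσM hσT hσ32 => ?_⟩
      rcases le_total a σ with h | h
      · have := hgap a σ (n + 1) ha0 h haM hσM haT hσT ha32
        constructor <;> linarith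
      · have := hgap σ a (n + 1) hσ h hσM haM hσT haT hσ32
        constructor <;> linarith
    · exact ⟨0, fun σ h1 h2 h3 h4 => absurd ⟨σ, h1, h2, h3, h4⟩ hne⟩
  choose a ha using hex
  set U : ℕ → Set ℝ := fun n => Set.Icc 0 (32 * ((n : ℝ) + 1) + 16) ∪
    Set.Icc (a n - 53 * ((n : ℝ) + 1)) (a n + 53 * ((n : ℝ) + 1)) with hU
  have hUm : ∀ n, MeasurableSet (U n) := fun n => measurableSet_Icc.union measurableSet_Icc
  have hUvol : ∀ n, volume (U n) ≤ ENNReal.ofReal (154 * (n + 1)) := fun n => by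
    refine (measure_union_le _ _).trans ?_
    have hn : (0 : ℝ) ≤ n := n.cast_nonneg
    rw [Real.volume_Icc, Real.volume_Icc, ← ENNReal.ofReal_add (by linarith) (by linarith)]
    refine ENNReal.ofReal_le_ofReal ?_
    linarith
  have hpt : ∀ σ ∈ Set.Ioi (0 : ℝ), M σ * ENNReal.ofReal (Real.exp σ) ≤
      ∑' n : ℕ, (U n).indicator (fun _ => ENNReal.ofReal (V * Real.exp (49 - n))) σ := by
    intro σ hσ
    by_cases hM0 : M σ = 0
    · simp [hM0]
    obtain ⟨hMσ, hTσ⟩ := hM σ hσ hM0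
    set n := ⌊T σ - σ + 49⌋₊ with hn
    have hn1 : (n : ℝ) ≤ T σ - σ + 49 := Nat.floor_le (by linarith)
    have hn2 : T σ - σ + 49 < n + 1 := Nat.lt_floor_add_one _
    refine le_trans ?_ (ENNReal.le_tsum n)
    have hmem : σ ∈ U n := by
      rcases le_or_gt (32 * ((n : ℝ) + 1)) (T σ + 1) with h | h
      · exact Or.inr (ha n σ hσ hM0 hn2.le h)
      · exact Or.inl ⟨(show (0 : ℝ) < σ from hσ).le, by linarith⟩
    rw [Set.indicator_of_mem hmem, hMσ, ← ENNReal.ofReal_mul (by positivity), mul_assoc,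
      ← Real.exp_add]
    refine ENNReal.ofReal_le_ofReal (mul_le_mul_of_nonneg_left (Real.exp_le_exp.mpr ?_) hV)
    linarith
  calc _ ≤ ∫⁻ σ in Set.Ioi (0 : ℝ),
        ∑' n : ℕ, (U n).indicator (fun _ => ENNReal.ofReal (V * Real.exp (49 - n))) σ :=
        setLIntegral_mono' measurableSet_Ioi hpt
    _ ≤ ∫⁻ σ, ∑' n : ℕ, (U n).indicator (fun _ => ENNReal.ofReal (V * Real.exp (49 - n))) σ :=
        setLIntegral_le_lintegral _ _
    _ = ∑' n : ℕ, ENNReal.ofReal (V * Real.exp (49 - n)) * volume (U n) := by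
        rw [lintegral_tsum fun n => (measurable_const.indicator (hUm n)).aemeasurable]
        exact tsum_congr fun n => lintegral_indicator_const (hUm n) _
    _ ≤ ∑' n : ℕ, ENNReal.ofReal V *
          ENNReal.ofReal (Real.exp (49 - n) * (154 * (n + 1))) := by
        refine ENNReal.tsum_le_tsum fun n => ?_
        rw [← ENNReal.ofReal_mul hV, ← mul_assoc,
          ENNReal.ofReal_mul (p := V * Real.exp (49 - n)) (by positivity)]
        gcongr
        exact hUvol n
    _ = _ := ENNReal.tsum_mul_left

/-- **Moser's inequality for Riesz potentials** (Adams): if `2 π w` is dominated by the potential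
of a function of unit square mass on a set of measure at most `π ρ²`, then the integral of
`e^{4 π w²} - 1` is bounded by a universal multiple of `π ρ²`. -/
lemma lintegral_exp_sub_one_le {ν : Measure Plane} [SFinite ν] (hν : ν ≤ volume)
    {g : Plane → ℝ≥0∞} (hg : Measurable g) (hg1 : ∫⁻ y, g y ^ 2 ∂ν ≤ 1) {ρ : ℝ} (hρ : 0 < ρ)
    (hmass : ν Set.univ ≤ ENNReal.ofReal (π * ρ ^ 2)) {w : Plane → ℝ} (hw : Measurable w)
    (hw0 : ∀ x, 0 ≤ w x) (hwsupp : volume {x | w x ≠ 0} ≤ ENNReal.ofReal (π * ρ ^ 2))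
    (hwg : ∀ x, ENNReal.ofReal (2 * π * w x) ≤
      ∫⁻ y, g y * (ENNReal.ofReal ‖x - y‖)⁻¹ ∂ν) :
    ∫⁻ x, ENNReal.ofReal (Real.exp (4 * π * w x ^ 2) - 1) ≤
      ENNReal.ofReal (π * ρ ^ 2) * moserConst := by
  set E : ℝ → Set Plane := fun σ => {x | σ < 4 * π * w x ^ 2} with hE
  have hEm : ∀ σ, MeasurableSet (E σ) := fun σ =>
    measurableSet_lt measurable_const ((hw.pow_const 2).const_mul _)
  have hEle : ∀ σ, 0 ≤ σ → volume (E σ) ≤ ENNReal.ofReal (π * ρ ^ 2) := fun σ hσ => by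
    refine (measure_mono fun x hx => ?_).trans hwsupp
    have hx' : σ < 4 * π * w x ^ 2 := hx
    intro h0
    rw [h0] at hx'
    norm_num at hx'
    linarith
  have hpot : ∀ σ, 0 ≤ σ → ∀ x ∈ E σ, ENNReal.ofReal (2 * π * (√σ / (2 * √π))) ≤
      ∫⁻ y, g y * (ENNReal.ofReal ‖x - y‖)⁻¹ ∂ν := fun σ hσ x hx => by
    refine le_trans (ENNReal.ofReal_le_ofReal ?_) (hwg x)
    gcongr
    have hx' : σ < 4 * π * w x ^ 2 := hx
    rw [div_le_iff₀ (by positivity), Real.sqrt_le_left (mul_nonneg (hw0 x) (by positivity)),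
      mul_pow, mul_pow, Real.sq_sqrt pi_pos.le]
    linarith
  have hroot : ∀ σ : ℝ, 2 * √π * (√σ / (2 * √π)) = √σ := fun σ =>
    mul_div_cancel₀ _ (by positivity)
  set R : ℝ → ℝ := fun σ => √((volume (E σ)).toReal / π) with hR
  have hRE : ∀ σ, 0 ≤ σ → volume (E σ) ≠ 0 →
      0 < R σ ∧ R σ ≤ ρ ∧ volume (E σ) = ENNReal.ofReal (π * R σ ^ 2) := fun σ hσ h0 => by
    have htop : volume (E σ) ≠ ∞ := ne_top_of_le_ne_top ENNReal.ofReal_ne_top (hEle σ hσ)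
    have hpos : 0 < (volume (E σ)).toReal := ENNReal.toReal_pos h0 htop
    refine ⟨Real.sqrt_pos.mpr (by positivity), ?_, ?_⟩
    · rw [hR, Real.sqrt_le_left hρ.le, div_le_iff₀ pi_pos, mul_comm]
      exact ENNReal.toReal_le_of_le_ofReal (by positivity) (hEle σ hσ)
    · rw [hR, Real.sq_sqrt (by positivity), mul_div_cancel₀ _ pi_pos.ne',
        ENNReal.ofReal_toReal htop]
  have hone : ∀ σ, 0 < σ → volume (E σ) ≠ 0 → ∀ χ : Plane → ℝ≥0∞, Measurable χ →
      (∀ y, χ y ≤ 1) → ∫⁻ y, χ y ∂ν ≤ ENNReal.ofReal (π * R σ ^ 2) →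
      σ ≤ 2 * Real.log (ρ / R σ) + 17 ∧ ∃ l : ℝ,
        ∫⁻ y, χ y * g y ^ 2 ∂ν ≤ ENNReal.ofReal (2 * l) ∧
        l * (2 * Real.log (ρ / R σ) + 1) ≤ 2 * (2 * Real.log (ρ / R σ) - σ + 49) := by
    intro σ hσ h0 χ hχ hχ1 hχint
    obtain ⟨hR0, hRρ, hER⟩ := hRE σ hσ.le h0
    obtain ⟨l, hl0, hl1, hlχ, hl⟩ := level_le_of_weight hν hg hg1 hR0 hRρ hmass (hEm σ) hER
      (hpot σ hσ.le) hχ hχ1 hχint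
    rw [hroot] at hl
    have hlog := Real.log_nonneg ((one_le_div hR0).mpr hRρ)
    obtain ⟨h1, h2⟩ := level_bounds_of_sqrt_le (by positivity) hl0 hl1 hσ.le hl
    exact ⟨h1, l, hlχ, h2⟩
  have hlower : ∀ σ, 0 < σ → volume (E σ) ≠ 0 → σ ≤ 2 * Real.log (ρ / R σ) + 17 :=
    fun σ hσ h0 => (hone σ hσ h0 0 measurable_zero (fun _ => zero_le) (by simp)).1
  have hlayer : ∫⁻ x, ENNReal.ofReal (Real.exp (4 * π * w x ^ 2) - 1) =
      ∫⁻ σ in Set.Ioi 0, volume (E σ) * ENNReal.ofReal (Real.exp σ) := by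
    rw [← lintegral_comp_eq_lintegral_meas_lt_mul volume
      (Filter.Eventually.of_forall fun x => by simp only [Pi.zero_apply]; positivity)
      ((hw.pow_const 2).const_mul _).aemeasurable
      (fun t _ => intervalIntegral.intervalIntegrable_exp)
      (Filter.Eventually.of_forall fun t => (Real.exp_pos t).le)]
    simp only [integral_exp, Real.exp_zero]
  rw [hlayer]
  refine lintegral_mul_exp_le (T := fun σ => 2 * Real.log (ρ / R σ)) (by positivity)
    (fun σ hσ h0 => ⟨?_, hlower σ hσ h0⟩) ?_
  · obtain ⟨hR0, hRρ, hER⟩ := hRE σ hσ.le h0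
    rw [hER]
    congr 1
    rw [← mul_neg, ← Real.log_inv, inv_div, two_mul, Real.exp_add,
      Real.exp_log (by positivity)]
    field_simp
  · intro σ₁ σ₂ Λ hσ₁ hσ h₁ h₂ hΛ₁ hΛ₂ h32
    have hσ₂ : 0 < σ₂ := hσ₁.trans_le hσ
    obtain ⟨hR₁, hRρ₁, hER₁⟩ := hRE σ₁ hσ₁.le h₁
    obtain ⟨hR₂, hRρ₂, hER₂⟩ := hRE σ₂ hσ₂.le h₂
    have hRR : R σ₂ ≤ R σ₁ := by
      refine Real.sqrt_le_sqrt ?_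
      gcongr
      · exact ne_top_of_le_ne_top ENNReal.ofReal_ne_top (hEle σ₁ hσ₁.le)
      · exact fun x hx => hσ.trans_lt hx
    have hlow₁ := hlower σ₁ hσ₁ h₁
    have hlow₂ := hlower σ₂ hσ₂ h₂
    have hlog₁ := Real.log_nonneg ((one_le_div hR₁).mpr hRρ₁)
    have hsplit : 2 * Real.log (ρ / R σ₂) - 2 * Real.log (ρ / R σ₁) =
        2 * Real.log (R σ₁ / R σ₂) := by
      rw [Real.log_div hρ.ne' hR₂.ne', Real.log_div hρ.ne' hR₁.ne',
        Real.log_div hR₁.ne' hR₂.ne']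
      ring
    have hlog₁₂ := Real.log_nonneg ((one_le_div hR₂).mpr hRR)
    have hΛ : 1 ≤ Λ := by linarith
    have htwo := level_le_of_concentration hν hg hg1 hR₂ hRR hRρ₁ hmass (hEm σ₂) hER₂
      (hpot σ₂ hσ₂.le) (ε := 4 * Λ / (2 * Real.log (ρ / R σ₁) + 1)) (by positivity) (by
        intro χ hχ hχ1 hχint
        obtain ⟨-, l, hlχ, hl⟩ := hone σ₁ hσ₁ h₁ χ hχ hχ1 hχint
        refine hlχ.trans (ENNReal.ofReal_le_ofReal ?_)
        rw [le_div_iff₀ (by positivity)]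
        linarith)
    rw [hroot, ← hsplit] at htwo
    have := sub_le_of_sqrt_le (by positivity) (by linarith) hσ₂.le hΛ h32 hΛ₂ htwo
    linarith

/-- A convenient upper bound for `e^s - 1` with `s` bounded. -/
lemma exp_sub_one_le_mul_exp (s : ℝ) : Real.exp s - 1 ≤ s * Real.exp s := by
  have h := Real.add_one_le_exp (-s)
  have h2 : Real.exp (-s) * Real.exp s = 1 := by rw [← Real.exp_add]; simp
  nlinarith [Real.exp_pos s]

/-- The integral of `e^{4πu²} - 1` in terms of the truncation `√(1 + A²) (|u| - A)₊`. -/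
lemma lintegral_exp_sub_one_le_truncation {u : Plane → ℝ} (hu : Measurable u) {A : ℝ}
    (hA1 : A ^ 2 ≤ 1) :
    ∫⁻ x, ENNReal.ofReal (Real.exp (4 * π * u x ^ 2) - 1) ≤
      ENNReal.ofReal (4 * π * Real.exp (4 * π)) * (∫⁻ x, ENNReal.ofReal (u x ^ 2)) +
      ENNReal.ofReal (Real.exp (8 * π)) *
        ((∫⁻ x, ENNReal.ofReal (Real.exp (4 * π * (√(1 + A ^ 2) * max (|u x| - A) 0) ^ 2) - 1)) +
          volume {x | A < |u x|}) := by
  have hΩ : MeasurableSet {x | A < |u x|} := measurableSet_lt measurable_const hu.abs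
  have hpt : ∀ x, ENNReal.ofReal (Real.exp (4 * π * u x ^ 2) - 1) ≤
      ENNReal.ofReal (4 * π * Real.exp (4 * π)) * ENNReal.ofReal (u x ^ 2) +
      ENNReal.ofReal (Real.exp (8 * π)) *
        (ENNReal.ofReal (Real.exp (4 * π * (√(1 + A ^ 2) * max (|u x| - A) 0) ^ 2) - 1) +
          {x | A < |u x|}.indicator 1 x) := by
    intro x
    rcases lt_or_ge A |u x| with h | h
    · refine le_add_of_nonneg_of_le zero_le ?_
      rw [Set.indicator_of_mem (by exact h), Pi.one_apply, max_eq_left (by linarith), mul_pow,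
        Real.sq_sqrt (by positivity), ← ENNReal.ofReal_one, ← ENNReal.ofReal_add
          (sub_nonneg.mpr (Real.one_le_exp (by positivity))) zero_le_one, sub_add_cancel,
        ← ENNReal.ofReal_mul (by positivity), ← Real.exp_add]
      refine ENNReal.ofReal_le_ofReal ((sub_le_self _ zero_le_one).trans
        (Real.exp_le_exp.mpr ?_))
      have hsq : u x ^ 2 ≤ (1 + A ^ 2) * (|u x| - A) ^ 2 + 2 := by
        rw [← sq_abs]
        nlinarith [sq_nonneg (A * (|u x| - A) - 1)]
      nlinarith [pi_pos]
    · refine le_add_of_le_of_nonneg ?_ zero_le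
      rw [← ENNReal.ofReal_mul (by positivity)]
      refine ENNReal.ofReal_le_ofReal ((exp_sub_one_le_mul_exp _).trans ?_)
      have hsq : u x ^ 2 ≤ 1 := by
        rw [← sq_abs]
        exact (pow_le_pow_left₀ (abs_nonneg _) h 2).trans hA1
      have hexp : Real.exp (4 * π * u x ^ 2) ≤ Real.exp (4 * π) :=
        Real.exp_le_exp.mpr (mul_le_of_le_one_right (by positivity) hsq)
      calc 4 * π * u x ^ 2 * Real.exp (4 * π * u x ^ 2)
          ≤ 4 * π * u x ^ 2 * Real.exp (4 * π) := by gcongr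
        _ = 4 * π * Real.exp (4 * π) * u x ^ 2 := by ring
  refine (lintegral_mono hpt).trans (le_of_eq ?_)
  rw [lintegral_add_left (by fun_prop), lintegral_const_mul _ (by fun_prop),
    lintegral_const_mul' _ _ ENNReal.ofReal_ne_top,
    lintegral_add_right _ (measurable_one.indicator hΩ), lintegral_indicator_one hΩ]

/-- sharp Trudinger–Moser inequality on `ℝ²`. -/
theorem statement5 (μ : ℝ) (hμ : 0 < μ) :
    ∃ C : ℝ, 0 < C ∧ ∀ u : Plane → ℝ, MemH1 u →
      (∫ x : Plane, gradNorm u x ^ 2) + μ ^ 2 * (∫ x : Plane, u x ^ 2) ≤ 1 →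
      ∫⁻ x : Plane, ENNReal.ofReal (Real.exp (4 * π * u x ^ 2) - 1) ≤
        ENNReal.ofReal C := by
  set ρ : ℝ := 1 / (μ * √π) with hρdef
  have hρ : 0 < ρ := by positivity
  have hπρ : π * ρ ^ 2 = 1 / μ ^ 2 := by
    rw [hρdef, div_pow, mul_pow, Real.sq_sqrt pi_pos.le]
    field_simp
  set K : ℝ≥0∞ := ENNReal.ofReal (4 * π * Real.exp (4 * π)) * ENNReal.ofReal (π * ρ ^ 2) +
    ENNReal.ofReal (Real.exp (8 * π)) *
      (ENNReal.ofReal (π * ρ ^ 2) * moserConst + ENNReal.ofReal (π * ρ ^ 2)) with hK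
  have hKtop : K ≠ ∞ := ENNReal.add_ne_top.mpr
    ⟨ENNReal.mul_ne_top ENNReal.ofReal_ne_top ENNReal.ofReal_ne_top,
      ENNReal.mul_ne_top ENNReal.ofReal_ne_top (ENNReal.add_ne_top.mpr
        ⟨ENNReal.mul_ne_top ENNReal.ofReal_ne_top moserConst_ne_top, ENNReal.ofReal_ne_top⟩)⟩
  refine ⟨K.toReal + 1, by positivity, fun u hu hle => ?_⟩
  suffices h : ∫⁻ x : Plane, ENNReal.ofReal (Real.exp (4 * π * u x ^ 2) - 1) ≤ K by
    refine h.trans ((ENNReal.ofReal_toReal hKtop).symm.le.trans (ENNReal.ofReal_le_ofReal ?_))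
    linarith
  obtain ⟨hdiff, hintg, hgrad⟩ := hu
  have hum : Measurable u := hdiff.continuous.measurable
  set a : ℝ := ∫ x : Plane, u x ^ 2 with ha
  have ha0 : 0 ≤ a := integral_nonneg fun x => sq_nonneg _
  have hb0 : 0 ≤ ∫ x : Plane, gradNorm u x ^ 2 := integral_nonneg fun x => sq_nonneg _
  have hla : ∫⁻ x, ENNReal.ofReal (u x ^ 2) = ENNReal.ofReal a :=
    (ofReal_integral_eq_lintegral_ofReal hintg (.of_forall fun x => sq_nonneg _)).symm
  rcases ha0.eq_or_lt with h0 | hapos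
  · have hzero : ∀ᵐ x, u x ^ 2 = 0 :=
      (integral_eq_zero_iff_of_nonneg (fun x => sq_nonneg _) hintg).mp h0.symm
    refine le_of_eq_of_le ?_ (zero_le (a := K))
    rw [lintegral_eq_zero_iff (by fun_prop)]
    filter_upwards [hzero] with x hx
    simp [hx]
  set A : ℝ := μ * √a with hAdef
  have hA : 0 < A := by positivity
  have hA2 : A ^ 2 = μ ^ 2 * a := by rw [hAdef, mul_pow, Real.sq_sqrt ha0]
  have hA1 : A ^ 2 ≤ 1 := by linarith
  have hvol : volume {x | A < |u x|} ≤ ENNReal.ofReal (π * ρ ^ 2) := by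
    have hmarkov := meas_ge_le_lintegral_div (μ := (volume : Measure Plane))
      (f := fun x => ENNReal.ofReal (u x ^ 2)) (by fun_prop)
      (ε := ENNReal.ofReal (A ^ 2)) (by simpa using hA.ne') ENNReal.ofReal_ne_top
    rw [hla, ← ENNReal.ofReal_div_of_pos (by positivity)] at hmarkov
    refine (measure_mono fun x hx => ?_).trans (hmarkov.trans_eq ?_)
    · refine ENNReal.ofReal_le_ofReal ?_
      rw [← sq_abs (u x)]
      exact pow_le_pow_left₀ hA.le (le_of_lt hx) 2
    · rw [hA2, hπρ]
      congr 1
      field_simp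
  refine (lintegral_exp_sub_one_le_truncation hum hA1).trans ?_
  rw [hla]
  have haρ : a ≤ π * ρ ^ 2 := by
    rw [hπρ, le_div_iff₀ (by positivity)]
    linarith
  rw [hK]
  gcongr
  have hfderiv : Measurable fun y => ‖fderiv ℝ u y‖ₑ := (measurable_fderiv ℝ u).enorm
  refine lintegral_exp_sub_one_le (ν := volume.restrict {x | A < |u x|}) Measure.restrict_le_self
    (g := fun y => ENNReal.ofReal √(1 + A ^ 2) * ‖fderiv ℝ u y‖ₑ) (hfderiv.const_mul _) ?_ hρ
    (by rwa [Measure.restrict_apply_univ])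
    (((hum.abs.sub_const A).max measurable_const).const_mul _)
    (fun x => by positivity) ((measure_mono fun x hx => ?_).trans hvol) fun x => ?_
  · simp only [mul_pow]
    rw [lintegral_const_mul _ (hfderiv.pow_const 2), ← ENNReal.ofReal_pow (by positivity),
      Real.sq_sqrt (by positivity)]
    have hlb : ∫⁻ y, ‖fderiv ℝ u y‖ₑ ^ 2 = ENNReal.ofReal (∫ x, gradNorm u x ^ 2) := by
      rw [ofReal_integral_eq_lintegral_ofReal hgrad (.of_forall fun x => sq_nonneg _)]
      refine lintegral_congr fun y => ?_
      rw [gradNorm, ENNReal.ofReal_pow (norm_nonneg _), ofReal_norm]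
    calc _ ≤ ENNReal.ofReal (1 + A ^ 2) * ENNReal.ofReal (∫ x, gradNorm u x ^ 2) := by
          rw [← hlb]
          gcongr
          exact Measure.restrict_le_self
      _ ≤ 1 := by
          rw [← ENNReal.ofReal_mul (by positivity), ENNReal.ofReal_le_one]
          nlinarith
  · by_contra h
    have h' : |u x| ≤ A := not_lt.mp h
    exact hx (by simp [max_eq_right (sub_nonpos.mpr h')])
  · have hpot := ofReal_sub_le_lintegral_potential hdiff
      (ne_top_of_le_ne_top ENNReal.ofReal_ne_top hvol) x
    calc ENNReal.ofReal (2 * π * (√(1 + A ^ 2) * max (|u x| - A) 0))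
        = ENNReal.ofReal √(1 + A ^ 2) * ENNReal.ofReal (2 * π * (|u x| - A)) := by
          rw [← ENNReal.ofReal_mul (by positivity)]
          rcases le_total (|u x| - A) 0 with h | h
          · rw [max_eq_right h, ENNReal.ofReal_of_nonpos (p := √(1 + A ^ 2) * _)
              (mul_nonpos_of_nonneg_of_nonpos (by positivity)
                (mul_nonpos_of_nonneg_of_nonpos (by positivity) h))]
            simp
          · rw [max_eq_left h]
            congr 1
            ring
      _ ≤ ENNReal.ofReal √(1 + A ^ 2) *
          ∫⁻ y in {y | A < |u y|}, ‖fderiv ℝ u y‖ₑ * (ENNReal.ofReal ‖x - y‖)⁻¹ := by gcongr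
      _ = _ := by
          rw [← lintegral_const_mul' _ _ ENNReal.ofReal_ne_top]
          simp only [mul_assoc]
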